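/- arXiv:2412.00635 — 2 statements merged into one kernel-verified Lean document; each statement's English description precedes it below -/
import Mathlib

section
/- Let d ≥ 3 and let G be a quasi-transitive d-regular locally finite, connected, infinite simple graph that contains at least one cycle. Then the connective constant satisfies μ(G) < d - 1. -/
open MeasureTheory
open scoped Classical ENNReal

/-- The Bernoulli measure on `Bool` with parameter `p` (`true` = open, with prob. `p`). -/
noncomputable def bernoulliMeasure (p : ℝ) : Measure Bool :=
  ENNReal.ofReal p • Measure.dirac true + ENNReal.ofReal (1 - p) • Measure.dirac false

/-- The Bernoulli(`p`) product measure on configurations `ι → Bool`, realized as the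
Carathéodory-extension outer measure of the product premeasure; on measurable sets it
is the usual i.i.d. Bernoulli product probability measure. -/
noncomputable def bernoulliProduct (ι : Type*) (p : ℝ) : OuterMeasure (ι → Bool) :=
  OuterMeasure.ofFunction
    (fun A : Set (ι → Bool) =>
      if A = ∅ then 0 else ∏' i : ι, bernoulliMeasure p (Function.eval i '' A))
    (by simp)

/-- The subgraph of open edges of the configuration `ω` (an edge `e` is open iff `ω e = true`). -/
def openSubgraph {V : Type*} (G : SimpleGraph V) (ω : G.edgeSet → Bool) : SimpleGraph V :=
  G.deleteEdges {e : Sym2 V | ∃ h : e ∈ G.edgeSet, ω ⟨e, h⟩ = false}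

/-- The event that the open subgraph has an infinite connected component. -/
def HasInfiniteCluster {V : Type*} (G : SimpleGraph V) (ω : G.edgeSet → Bool) : Prop :=
  ∃ v : V, {w : V | (openSubgraph G ω).Reachable v w}.Infinite

/-- The critical percolation threshold
`p_c(G) = sup {p ∈ [0,1] | ℙ_p(∃ an infinite connected component) = 0}`. -/
noncomputable def pc {V : Type*} (G : SimpleGraph V) : ℝ :=
  sSup {p : ℝ | p ∈ Set.Icc (0 : ℝ) 1 ∧
    bernoulliProduct G.edgeSet p {ω | HasInfiniteCluster G ω} = 0}

/-- A graph is quasi-transitive if its automorphism group acts on the vertices with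
finitely many orbits, i.e. there is a finite set meeting every orbit. -/
def QuasiTransitive {V : Type*} (G : SimpleGraph V) : Prop :=
  ∃ S : Finset V, ∀ v : V, ∃ φ : G ≃g G, φ v ∈ S

/-- The set of self-avoiding walks of length `n` in `G` starting at `o`. -/
def SAW {V : Type*} (G : SimpleGraph V) (o : V) (n : ℕ) : Set (Σ v : V, G.Walk o v) :=
  {q | q.2.IsPath ∧ q.2.length = n}

/-- The connective constant `μ(G) = lim_n |SAW_n|^{1/n}` (written as a `limsup`;
the limit exists by Fekete's subadditivity lemma). -/
noncomputable def connectiveConstant {V : Type*} (G : SimpleGraph V) (o : V) : ℝ :=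
  Filter.limsup (fun n : ℕ => (Nat.card (SAW G o n) : ℝ) ^ ((n : ℝ)⁻¹)) Filter.atTop

namespace SimpleGraph

variable {V : Type*} {G : SimpleGraph V}

/-- The list `l` continues the dart `u → v` to a walk without backtracking. -/
def NonBacktracking (G : SimpleGraph V) : V → V → List V → Prop
  | _, _, [] => True
  | u, v, x :: l => G.Adj v x ∧ x ≠ u ∧ NonBacktracking G v x l

/-- The last two vertices of the list `u :: v :: l`. -/
def lastTwo : V → V → List V → V × V
  | u, v, [] => (u, v)
  | _, v, x :: l => lastTwo v x l

theorem nonBacktracking_append {u v : V} {l l' : List V} :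
    G.NonBacktracking u v (l ++ l') ↔ G.NonBacktracking u v l ∧
      G.NonBacktracking (lastTwo u v l).1 (lastTwo u v l).2 l' := by
  induction l generalizing u v with
  | nil => simp [NonBacktracking, lastTwo]
  | cons x l ih => simp [NonBacktracking, lastTwo, ih, and_assoc]

theorem lastTwo_append (u v : V) (l l' : List V) :
    lastTwo u v (l ++ l') = lastTwo (lastTwo u v l).1 (lastTwo u v l).2 l' := by
  induction l generalizing u v with
  | nil => rfl
  | cons x l ih => exact ih v x

theorem lastTwo_snd_mem (u v : V) (l : List V) : (lastTwo u v l).2 ∈ u :: v :: l := by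
  induction l generalizing u v with
  | nil => simp [lastTwo]
  | cons x l ih => exact List.mem_cons_of_mem _ (ih v x)

theorem NonBacktracking.adj_lastTwo {u v : V} {l : List V} (huv : G.Adj u v)
    (h : G.NonBacktracking u v l) : G.Adj (lastTwo u v l).1 (lastTwo u v l).2 := by
  induction l generalizing u v with
  | nil => exact huv
  | cons x l ih => exact ih h.1 h.2.2

theorem nodup_lastTwo_append {u v : V} {l l' : List V} (h : (u :: v :: (l ++ l')).Nodup) :
    ((lastTwo u v l).1 :: (lastTwo u v l).2 :: l').Nodup := by
  induction l generalizing u v with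
  | nil => exact h
  | cons x l ih => exact ih (List.Nodup.of_cons h)

theorem NonBacktracking.map {u v : V} {l : List V} (φ : G ≃g G)
    (h : G.NonBacktracking u v l) : G.NonBacktracking (φ u) (φ v) (l.map φ) := by
  induction l generalizing u v with
  | nil => trivial
  | cons x l ih => exact ⟨φ.map_adj_iff.2 h.1, φ.injective.ne h.2.1, ih h.2.2⟩

theorem Walk.IsTrail.nonBacktracking {u x y : V} {q : G.Walk x y} (hq : q.IsTrail)
    (hu : s(u, x) ∉ q.edges) : G.NonBacktracking u x q.support.tail := by
  induction q generalizing u with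
  | nil => trivial
  | cons h q ih =>
    rw [Walk.isTrail_cons] at hq
    rw [Walk.support_cons, List.tail_cons, ← Walk.cons_tail_support]
    refine ⟨h, ?_, ih hq.1 hq.2⟩
    rintro rfl
    simp [Sym2.eq_swap] at hu

/-- Any arrival at `c` can be continued without backtracking for `L` steps so as to
revisit `c`. -/
def HasLoop (G : SimpleGraph V) (c : V) (L : ℕ) : Prop :=
  ∀ a : V, ∃ l : List V, l.length = L ∧ c ∈ l ∧ G.NonBacktracking a c l

theorem HasLoop.map {c : V} {L : ℕ} (h : G.HasLoop c L) (φ : G ≃g G) : G.HasLoop (φ c) L := by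
  intro a
  obtain ⟨l, hl, hc, hb⟩ := h (φ.symm a)
  refine ⟨l.map φ, by simpa using hl, List.mem_map_of_mem hc, ?_⟩
  simpa using hb.map φ

theorem Walk.IsCycle.nonBacktracking {a c : V} {p : G.Walk c c} (hp : p.IsCycle)
    (ha : p.snd ≠ a) : G.NonBacktracking a c p.support.tail := by
  cases p with
  | nil => exact absurd hp Walk.not_isCycle_nil
  | cons h q =>
    rw [Walk.support_cons, List.tail_cons, ← Walk.cons_tail_support]
    have := (Walk.isTrail_cons h q).1 hp.isTrail
    exact ⟨h, by simpa using ha, this.1.nonBacktracking this.2⟩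

theorem Walk.IsCycle.hasLoop {c : V} {p : G.Walk c c} (hp : p.IsCycle) :
    G.HasLoop c p.length := by
  intro a
  by_cases ha : p.snd = a
  · refine ⟨p.reverse.support.tail, by simp, Walk.end_mem_tail_support hp.reverse.not_nil,
      hp.reverse.nonBacktracking ?_⟩
    rw [Walk.snd_reverse, ← ha]
    exact hp.snd_ne_penultimate.symm
  · exact ⟨p.support.tail, by simp, Walk.end_mem_tail_support hp.not_nil,
      hp.nonBacktracking ha⟩

theorem NonBacktracking.exists_lastTwo_snd_eq {u v b c : V} (q : G.Walk b c) {l : List V}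
    (hl : G.NonBacktracking u v l) (hb : (lastTwo u v l).2 = b) (hlen : q.length ≤ l.length) :
    ∃ l' : List V, G.NonBacktracking u v l' ∧ (lastTwo u v l').2 = c ∧
      l'.length ≤ l.length + q.length := by
  induction q generalizing l with
  | nil => exact ⟨l, hl, hb, by simp⟩
  | @cons b x c h q ih =>
    rw [Walk.length_cons] at hlen
    by_cases hx : x = (lastTwo u v l).1
    · obtain rfl | ⟨l₀, y, rfl⟩ := l.eq_nil_or_concat
      · simp at hlen
      · simp only [List.concat_eq_append, List.length_append, List.length_singleton] at *
        have h₀ : (lastTwo u v l₀).2 = x := by rw [hx, lastTwo_append]; rfl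
        obtain ⟨l', h₁, h₂, h₃⟩ := ih (nonBacktracking_append.1 hl).1 h₀ (by omega)
        exact ⟨l', h₁, h₂, by rw [Walk.length_cons]; omega⟩
    · obtain ⟨l', h₁, h₂, h₃⟩ := ih (l := l ++ [x])
        (nonBacktracking_append.2 ⟨hl, hb ▸ h, hx, trivial⟩)
        (by rw [lastTwo_append]; rfl) (by simp; omega)
      refine ⟨l', h₁, h₂, ?_⟩
      simp only [List.length_append, List.length_singleton] at h₃
      rw [Walk.length_cons]; omega

theorem NonBacktracking.exists_append (hnb : ∀ u v : V, ∃ x, G.Adj v x ∧ x ≠ u) {u v : V}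
    {l : List V} (hl : G.NonBacktracking u v l) (n : ℕ) :
    ∃ l' : List V, l'.length = n ∧ G.NonBacktracking u v (l ++ l') := by
  induction n with
  | zero => exact ⟨[], rfl, by simpa using hl⟩
  | succ n ih =>
    obtain ⟨l', h₁, h₂⟩ := ih
    obtain ⟨x, hx, hxu⟩ := hnb (lastTwo u v (l ++ l')).1 (lastTwo u v (l ++ l')).2
    refine ⟨l' ++ [x], by simp [h₁], ?_⟩
    rw [← List.append_assoc]
    exact nonBacktracking_append.2 ⟨h₂, hx, hxu, trivial⟩

theorem exists_nonBacktracking_not_nodup (hnb : ∀ u v : V, ∃ x, G.Adj v x ∧ x ≠ u) {R L : ℕ}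
    (hR : ∀ v : V, ∃ c, ∃ q : G.Walk v c, q.length ≤ R ∧ G.HasLoop c L) (u v : V) :
    ∃ l : List V, l.length = 2 * R + L ∧ G.NonBacktracking u v l ∧ ¬ (u :: v :: l).Nodup := by
  obtain ⟨l₀, hl₀, h₀⟩ :=
    NonBacktracking.exists_append hnb (G := G) (u := u) (v := v) (l := []) trivial R
  obtain ⟨c, q, hq, hc⟩ := hR (lastTwo u v l₀).2
  rw [List.nil_append] at h₀
  obtain ⟨l₁, h₁, hc₁, hl₁⟩ := NonBacktracking.exists_lastTwo_snd_eq q h₀ rfl (by omega)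
  obtain ⟨l₂, hl₂, hc₂, h₂⟩ := hc (lastTwo u v l₁).1
  obtain ⟨l₃, hl₃, h₃⟩ := NonBacktracking.exists_append hnb
    (nonBacktracking_append.2 ⟨h₁, by rwa [hc₁]⟩) (2 * R + L - (l₁ ++ l₂).length)
  have hlen : (l₁ ++ l₂).length ≤ 2 * R + L := by
    simp only [List.length_append] at *; omega
  refine ⟨l₁ ++ l₂ ++ l₃, by rw [List.length_append]; omega, h₃, fun hnd => ?_⟩
  have hmem := lastTwo_snd_mem u v l₁
  rw [hc₁] at hmem
  rw [List.append_assoc, ← List.cons_append, ← List.cons_append] at hnd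
  exact (List.nodup_append.1 hnd).2.2 c hmem c (by simp [hc₂]) rfl

/-- The continuations of the dart `u → v` by `n` non-backtracking steps. -/
noncomputable def nonBacktrackingLists (hlf : ∀ v : V, (G.neighborSet v).Finite) :
    V → V → ℕ → Finset (List V)
  | _, _, 0 => {[]}
  | u, v, n + 1 => ((hlf v).toFinset.erase u).biUnion fun x =>
      (nonBacktrackingLists hlf v x n).image (List.cons x)

variable (hlf : ∀ v : V, (G.neighborSet v).Finite)

theorem mem_nonBacktrackingLists {u v : V} {n : ℕ} {l : List V} :
    l ∈ nonBacktrackingLists hlf u v n ↔ l.length = n ∧ G.NonBacktracking u v l := by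
  induction n generalizing u v l with
  | zero =>
    cases l <;> simp [nonBacktrackingLists, NonBacktracking]
  | succ n ih =>
    cases l with
    | nil => simp [nonBacktrackingLists]
    | cons x l =>
      simp [nonBacktrackingLists, NonBacktracking, ih]
      tauto

theorem card_nonBacktrackingLists_le {d : ℕ} (hreg : ∀ v : V, (G.neighborSet v).ncard = d)
    {u v : V} (huv : G.Adj u v) (n : ℕ) :
    (nonBacktrackingLists hlf u v n).card ≤ (d - 1) ^ n := by
  induction n generalizing u v with
  | zero => simp [nonBacktrackingLists]
  | succ n ih =>
    have hcard : ((hlf v).toFinset.erase u).card = d - 1 := by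
      rw [Finset.card_erase_of_mem (by simpa using huv.symm), ← Set.ncard_eq_toFinset_card _ (hlf v), hreg]
    rw [nonBacktrackingLists, pow_succ', ← hcard]
    refine Finset.card_biUnion_le_card_mul _ _ _ fun x hx => Finset.card_image_le.trans ?_
    exact hcard ▸ ih (by simpa using (Finset.mem_erase.1 hx).2)

/-- The continuations of the dart `u → v` to a self-avoiding walk by `n` further steps. -/
noncomputable def selfAvoidingLists (u v : V) (n : ℕ) : Finset (List V) :=
  (nonBacktrackingLists hlf u v n).filter fun l => (u :: v :: l).Nodup

theorem mem_selfAvoidingLists {u v : V} {n : ℕ} {l : List V} :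
    l ∈ selfAvoidingLists hlf u v n ↔
      l.length = n ∧ G.NonBacktracking u v l ∧ (u :: v :: l).Nodup := by
  rw [selfAvoidingLists, Finset.mem_filter, mem_nonBacktrackingLists, and_assoc]

theorem card_selfAvoidingLists_add_le {u v : V} (huv : G.Adj u v) {m n B C : ℕ}
    (hB : (selfAvoidingLists hlf u v m).card ≤ B)
    (hC : ∀ a b : V, G.Adj a b → (selfAvoidingLists hlf a b n).card ≤ C) :
    (selfAvoidingLists hlf u v (m + n)).card ≤ B * C := by
  refine (Finset.card_le_mul_card_image_of_maps_to (f := List.take m)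
    (t := selfAvoidingLists hlf u v m) ?_ C ?_).trans ?_
  · intro l hl
    rw [mem_selfAvoidingLists] at hl ⊢
    obtain ⟨h₁, h₂, h₃⟩ := hl
    refine ⟨by simp [h₁], ?_, h₃.sublist (((List.take_sublist m l).cons_cons v).cons_cons u)⟩
    rw [← List.take_append_drop m l] at h₂
    exact (nonBacktracking_append.1 h₂).1
  · intro l₁ hl₁
    refine le_trans (Finset.card_le_card_of_injOn (List.drop m) ?_ ?_)
      (hC (lastTwo u v l₁).1 (lastTwo u v l₁).2
        (((mem_selfAvoidingLists hlf).1 hl₁).2.1.adj_lastTwo huv))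
    · intro l hl
      simp only [Finset.coe_filter, Set.mem_ofPred_eq, mem_selfAvoidingLists] at hl
      obtain ⟨⟨h₁, h₂, h₃⟩, rfl⟩ := hl
      rw [← List.take_append_drop m l] at h₂ h₃
      exact (mem_selfAvoidingLists hlf).2 ⟨by simp [h₁], (nonBacktracking_append.1 h₂).2,
        nodup_lastTwo_append h₃⟩
    · intro l hl l' hl' h
      simp only [Finset.coe_filter, Set.mem_ofPred_eq] at hl hl'
      rw [← List.take_append_drop m l, ← List.take_append_drop m l', h, hl.2, hl'.2]
  · rw [mul_comm]
    exact Nat.mul_le_mul_right C hB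

theorem card_selfAvoidingLists_le {K M B : ℕ}
    (hM : ∀ u v : V, G.Adj u v → (selfAvoidingLists hlf u v K).card ≤ M)
    (hB : ∀ r < K, ∀ u v : V, G.Adj u v → (selfAvoidingLists hlf u v r).card ≤ B)
    (hK : 0 < K) (n : ℕ) {u v : V} (huv : G.Adj u v) :
    (selfAvoidingLists hlf u v n).card ≤ M ^ (n / K) * B := by
  have key : ∀ k r, r < K → ∀ u v : V, G.Adj u v →
      (selfAvoidingLists hlf u v (K * k + r)).card ≤ M ^ k * B := by
    intro k r hr
    induction k with
    | zero => simpa using hB r hr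
    | succ k ih =>
      intro u v huv
      have := card_selfAvoidingLists_add_le hlf huv (hM u v huv) ih
      rwa [← mul_assoc, ← pow_succ', ← add_assoc, add_comm K, ← Nat.mul_succ] at this
  simpa only [Nat.div_add_mod] using key (n / K) (n % K) (Nat.mod_lt _ hK) u v huv

theorem card_SAW_succ_le {d n B : ℕ} (hreg : ∀ v : V, (G.neighborSet v).ncard = d) (o : V)
    (hB : ∀ v : V, G.Adj o v → (selfAvoidingLists hlf o v n).card ≤ B) :
    Nat.card (SAW G o (n + 1)) ≤ d * B := by
  let T := (hlf o).toFinset.biUnion fun v => (selfAvoidingLists hlf o v n).image (List.cons v)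
  have hT : T.card ≤ d * B := by
    rw [← hreg o, Set.ncard_eq_toFinset_card _ (hlf o)]
    exact Finset.card_biUnion_le_card_mul _ _ _ fun v hv =>
      Finset.card_image_le.trans (hB v (by simpa using hv))
  have hmem : ∀ q : SAW G o (n + 1), q.1.2.support.tail ∈ T := by
    rintro ⟨⟨w, p⟩, hp, hlen⟩
    cases p with
    | nil => simp at hlen
    | @cons _ v _ h q =>
      have htrail := (Walk.isTrail_cons h q).1 hp.isTrail
      have hnd := hp.support_nodup
      rw [Walk.support_cons, ← Walk.cons_tail_support] at hnd
      refine Finset.mem_biUnion.2 ⟨v, by simpa using h, Finset.mem_image.2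
        ⟨q.support.tail, (mem_selfAvoidingLists hlf).2
          ⟨by simpa using hlen, htrail.1.nonBacktracking htrail.2, hnd⟩, ?_⟩⟩
      simp
  refine le_trans ?_ hT
  rw [← Nat.card_eq_finsetCard]
  refine Nat.card_le_card_of_injective
    (fun q : SAW G o (n + 1) => (⟨q.1.2.support.tail, hmem q⟩ : T)) ?_
  rintro ⟨⟨v, p⟩, hp⟩ ⟨⟨w, q⟩, hq⟩ h
  have hs : p.support = q.support := by
    rw [← Walk.cons_tail_support p, ← Walk.cons_tail_support q]
    exact congrArg _ (congrArg Subtype.val h)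
  obtain rfl : v = w := by
    have := p.getLast_support
    simp_rw [hs, Walk.getLast_support] at this
    exact this.symm
  obtain rfl := Walk.ext_support hs
  rfl

end SimpleGraph

theorem connectiveConstant_le_of_card_le {V : Type*} {G : SimpleGraph V} {o : V} {C ρ : ℝ}
    (hC : 0 < C) (hρ : 0 ≤ ρ)
    (h : ∀ᶠ n : ℕ in Filter.atTop, (Nat.card (SAW G o n) : ℝ) ≤ C * ρ ^ n) :
    connectiveConstant G o ≤ ρ := by
  have hlim : Filter.Tendsto (fun n : ℕ => C ^ ((n : ℝ)⁻¹) * ρ) Filter.atTop (nhds ρ) := by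
    have h0 := (Real.continuousAt_const_rpow (b := 0) hC.ne').tendsto.comp
      (tendsto_inv_atTop_nhds_zero_nat (𝕜 := ℝ))
    simpa using h0.mul_const ρ
  rw [← hlim.limsup_eq]
  refine Filter.limsup_le_limsup ?_ ?_ hlim.isBoundedUnder_le
  · filter_upwards [h, Filter.eventually_ne_atTop 0] with n hn hn0
    refine (Real.rpow_le_rpow (Nat.cast_nonneg _) hn (by positivity)).trans_eq ?_
    rw [Real.mul_rpow hC.le (by positivity), Real.pow_rpow_inv_natCast hρ hn0]
  · exact Filter.isCoboundedUnder_le_of_le _ (x := 0) fun n => by positivity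

theorem QuasiTransitive.exists_bounded_walk {V : Type*} {G : SimpleGraph V}
    (hqt : QuasiTransitive G) (hconn : G.Connected) (c : V) :
    ∃ R : ℕ, ∀ v : V, ∃ φ : G ≃g G, ∃ q : G.Walk v (φ c), q.length ≤ R := by
  obtain ⟨S, hS⟩ := hqt
  refine ⟨S.sup fun s => G.dist s c, fun v => ?_⟩
  obtain ⟨φ, hφ⟩ := hS v
  obtain ⟨p, hp⟩ := hconn.exists_walk_length_eq_dist (φ v) c
  refine ⟨φ.symm, (p.map φ.symm.toHom).copy (by simp) rfl, ?_⟩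
  simpa [hp] using Finset.le_sup (f := fun s => G.dist s c) hφ

/-- Grimmett–Li. For `d ≥ 3`, a quasi-transitive `d`-regular locally
finite, connected, infinite simple graph with a cycle has connective constant `μ(G) < d - 1`. -/
theorem connectiveConstant_lt {V : Type*} (G : SimpleGraph V) (d : ℕ) (hd : 3 ≤ d)
    (hconn : G.Connected) (hinf : Infinite V)
    (hlf : ∀ v : V, (G.neighborSet v).Finite)
    (hreg : ∀ v : V, (G.neighborSet v).ncard = d)
    (hqt : QuasiTransitive G) (hcyc : ¬ G.IsAcyclic) (o : V) :
    connectiveConstant G o < (d : ℝ) - 1 := by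
  obtain ⟨c, p, hp⟩ : ∃ c, ∃ p : G.Walk c c, p.IsCycle := by
    simpa [SimpleGraph.IsAcyclic] using hcyc
  obtain ⟨R, hR⟩ := hqt.exists_bounded_walk hconn c
  have hnb : ∀ u v : V, ∃ x, G.Adj v x ∧ x ≠ u := fun u v => by
    obtain ⟨x, hx, hxu⟩ := Set.exists_ne_of_one_lt_ncard (s := G.neighborSet v)
      (by rw [hreg]; omega) u
    exact ⟨x, hx, hxu⟩
  have hbad := SimpleGraph.exists_nonBacktracking_not_nodup (R := R) (L := p.length) hnb
    fun v => by
      obtain ⟨φ, q, hq⟩ := hR v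
      exact ⟨φ c, q, hq, hp.hasLoop.map φ⟩
  set K := 2 * R + p.length with hKdef
  have hK : 0 < K := by have := hp.three_le_length; omega
  set M := (d - 1) ^ K - 1
  have hpow : 2 ≤ (d - 1) ^ K :=
    (show 2 ≤ d - 1 by omega).trans (Nat.le_self_pow hK.ne' _)
  have hM : ∀ u v : V, G.Adj u v → (SimpleGraph.selfAvoidingLists hlf u v K).card ≤ M := by
    intro u v huv
    obtain ⟨l, h₁, h₂, h₃⟩ := hbad u v
    refine Nat.le_sub_one_of_lt (lt_of_lt_of_le (Finset.card_lt_card ?_)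
      (SimpleGraph.card_nonBacktrackingLists_le hlf hreg huv K))
    exact Finset.filter_ssubset.2
      ⟨l, (SimpleGraph.mem_nonBacktrackingLists hlf).2 ⟨h₁, h₂⟩, h₃⟩
  have hB : ∀ r < K, ∀ u v : V, G.Adj u v →
      (SimpleGraph.selfAvoidingLists hlf u v r).card ≤ (d - 1) ^ K := fun r hr u v huv =>
    (Finset.card_filter_le _ _).trans <|
      (SimpleGraph.card_nonBacktrackingLists_le hlf hreg huv r).trans
        (Nat.pow_le_pow_right (by omega) hr.le)
  have hSAW : ∀ n, Nat.card (SAW G o (n + 1)) ≤ d * (M ^ (n / K) * (d - 1) ^ K) := fun n =>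
    SimpleGraph.card_SAW_succ_le hlf hreg o fun v hv =>
      SimpleGraph.card_selfAvoidingLists_le hlf hM hB hK n hv
  have hM1 : (1 : ℝ) ≤ M := by exact_mod_cast (show 1 ≤ M by omega)
  set ρ : ℝ := (M : ℝ) ^ ((K : ℝ)⁻¹)
  have hρK : ρ ^ K = M := Real.rpow_inv_natCast_pow (by positivity) hK.ne'
  have hρ1 : 1 ≤ ρ := Real.one_le_rpow hM1 (by positivity)
  have hρd : ρ < (d : ℝ) - 1 := by
    have hd1 : ((d - 1 : ℕ) : ℝ) = (d : ℝ) - 1 := by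
      rw [Nat.cast_sub (by omega), Nat.cast_one]
    rw [← hd1]
    refine lt_of_pow_lt_pow_left₀ K (by positivity) ?_
    rw [hρK]
    exact_mod_cast (show M < (d - 1) ^ K by omega)
  refine lt_of_le_of_lt (connectiveConstant_le_of_card_le
    (C := (d * (d - 1) ^ K : ℕ)) ?_ (by positivity) ?_) hρd
  · exact_mod_cast Nat.mul_pos (by omega) (by omega)
  · filter_upwards [Filter.eventually_ne_atTop 0] with n hn
    obtain ⟨n, rfl⟩ := Nat.exists_eq_succ_of_ne_zero hn
    calc (Nat.card (SAW G o (n + 1)) : ℝ)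
        ≤ (d * (M ^ (n / K) * (d - 1) ^ K) : ℕ) := by exact_mod_cast hSAW n
      _ = (d * (d - 1) ^ K : ℕ) * ρ ^ (K * (n / K)) := by
        rw [pow_mul, hρK]; push_cast; ring
      _ ≤ (d * (d - 1) ^ K : ℕ) * ρ ^ (n + 1) := by
        gcongr
        · exact (Nat.mul_div_le n K).trans n.le_succ
end

section
/- Let T be a locally finite, infinite tree with root O. Then p_c(T) = 1/br(T), where br(T) is the branching number of T. -/
open MeasureTheory
open scoped Classical ENNReal

/-- The distance of an edge `e` from the root `O`: the minimal distance from `O`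
to an endpoint of `e`. -/
noncomputable def edgeDist {V : Type*} (G : SimpleGraph V) (O : V) (e : Sym2 V) : ℕ :=
  sInf {n : ℕ | ∃ x ∈ e, G.dist O x = n}

/-- A set of edges `π` is a cutset (separating `O` from infinity) if deleting it leaves
the connected component of `O` finite. -/
def IsCutset {V : Type*} (G : SimpleGraph V) (O : V) (π : Set (Sym2 V)) : Prop :=
  {w : V | (G.deleteEdges π).Reachable O w}.Finite

/-- The branching number
`br(T) = sup {λ ≥ 1 | inf_π Σ_{e ∈ π} λ^{-|e|} > 0}`, the infimum being over all
cutsets `π` separating the root from infinity. -/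
noncomputable def branchingNumber {V : Type*} (G : SimpleGraph V) (O : V) : ℝ :=
  sSup {l : ℝ | 1 ≤ l ∧
    0 < ⨅ π : {π : Set (Sym2 V) // IsCutset G O π},
      ∑' e : π.1, ENNReal.ofReal (l⁻¹ ^ edgeDist G O e)}

section RootedTree

variable {V : Type*}

/-- The parent structure of a tree rooted at `O`: every vertex has a parent and an edge leading to
it (with junk values at the root), and every edge of the tree arises in this way. -/
structure ParentData (T : SimpleGraph V) (O : V) where
  /-- The parent of a vertex. -/
  par : V → V
  /-- The edge from a vertex to its parent. -/
  edge : V → T.edgeSet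
  edge_eq : ∀ z, z ≠ O → (edge z : Sym2 V) = s(par z, z)
  dist_eq : ∀ z, z ≠ O → T.dist O z = T.dist O (par z) + 1
  adj : ∀ a b, T.Adj a b → (a ≠ O ∧ par a = b) ∨ (b ≠ O ∧ par b = a)

theorem SimpleGraph.IsTree.eq_of_adj_of_dist_lt {T : SimpleGraph V} (hT : T.IsTree) {O v a b : V}
    (ha : T.Adj v a) (hb : T.Adj v b) (hda : T.dist O v = T.dist O a + 1)
    (hdb : T.dist O v = T.dist O b + 1) : a = b := by
  obtain ⟨p, hp⟩ := hT.connected.exists_walk_length_eq_dist O a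
  obtain ⟨q, hq⟩ := hT.connected.exists_walk_length_eq_dist O b
  have hp' := (p.concat ha.symm).isPath_of_length_eq_dist (by simp [hp, hda])
  have hq' := (q.concat hb.symm).isPath_of_length_eq_dist (by simp [hq, hdb])
  have h := Subtype.mk.inj ((hT.isAcyclic.subsingleton_path _ _).elim ⟨_, hp'⟩ ⟨_, hq'⟩)
  simpa using congrArg SimpleGraph.Walk.penultimate h

theorem SimpleGraph.IsTree.nonempty_parentData {T : SimpleGraph V} (hT : T.IsTree) (O : V)
    (hinf : Infinite V) : Nonempty (ParentData T O) := by
  have hpar : ∀ z, ∃ w, z ≠ O → T.Adj z w ∧ T.dist O z = T.dist O w + 1 := by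
    intro z
    by_cases hz : z = O
    · exact ⟨O, fun h => absurd hz h⟩
    obtain ⟨w, hd⟩ := hT.connected.exists_walk_length_eq_dist z O
    cases w with
    | nil => exact absurd rfl hz
    | @cons _ w _ h q =>
      refine ⟨w, fun _ => ⟨h, ?_⟩⟩
      have h1 := SimpleGraph.dist_le q
      rw [SimpleGraph.Walk.length_cons] at hd
      have h2 := hT.dist_eq_dist_add_one_of_adj O h
      rw [SimpleGraph.dist_comm, SimpleGraph.dist_comm (v := w)] at h2 ⊢
      omega
  choose par hpar using hpar
  obtain ⟨z₀, hz₀⟩ := exists_ne O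
  let e₀ : T.edgeSet := ⟨s(par z₀, z₀), (hpar z₀ hz₀).1.symm⟩
  refine ⟨⟨par, fun z => if h : z ≠ O then ⟨s(par z, z), (hpar z h).1.symm⟩ else e₀, ?_, ?_, ?_⟩⟩
  · intro z hz
    simp [hz]
  · exact fun z hz => (hpar z hz).2
  · intro a b hab
    rcases hT.dist_eq_dist_add_one_of_adj O hab with h | h
    · have ha : a ≠ O := by rintro rfl; simp at h
      exact .inl ⟨ha, hT.eq_of_adj_of_dist_lt (hpar a ha).1 hab (hpar a ha).2 h⟩
    · have hb : b ≠ O := by rintro rfl; simp at h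
      exact .inr ⟨hb, hT.eq_of_adj_of_dist_lt (hpar b hb).1 hab.symm (hpar b hb).2 h⟩

variable {T : SimpleGraph V} {O : V}

namespace ParentData

variable (D : ParentData T O)
include D

theorem adj_par {z : V} (hz : z ≠ O) : T.Adj (D.par z) z := by
  have := (D.edge z).2
  rwa [D.edge_eq z hz] at this

theorem finite_dist_lt (hlf : ∀ v : V, (T.neighborSet v).Finite) (n : ℕ) :
    {w : V | T.dist O w < n}.Finite := by
  induction n with
  | zero => simp
  | succ n ih =>
    refine ((Set.finite_singleton O).union (ih.biUnion fun v _ => hlf v)).subset fun w hw => ?_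
    by_cases hO : w = O
    · exact .inl hO
    · have h := D.dist_eq w hO
      simp only [Set.mem_ofPred_eq] at hw
      exact .inr (Set.mem_biUnion (x := D.par w) (show T.dist O (D.par w) < n by omega)
        (D.adj_par hO))

theorem countable (hlf : ∀ v : V, (T.neighborSet v).Finite) : Countable V := by
  rw [← Set.countable_univ_iff]
  refine (Set.countable_iUnion fun n => (D.finite_dist_lt hlf n).countable).mono fun w _ =>
    Set.mem_iUnion.2 ⟨T.dist O w + 1, Nat.lt_succ_self _⟩

theorem edge_injOn {a b : V} (ha : a ≠ O) (hb : b ≠ O) (h : D.edge a = D.edge b) : a = b := by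
  have h' := congrArg Subtype.val h
  rw [D.edge_eq a ha, D.edge_eq b hb, Sym2.eq_iff] at h'
  rcases h' with h' | ⟨h1, h2⟩
  · exact h'.2
  · have h3 := D.dist_eq a ha
    have h4 := D.dist_eq b hb
    rw [h1] at h3; rw [← h2] at h4
    omega

theorem edgeDist_edge {z : V} (hz : z ≠ O) : edgeDist T O (D.edge z) = T.dist O (D.par z) := by
  rw [D.edge_eq z hz, edgeDist]
  have h := D.dist_eq z hz
  apply le_antisymm
  · exact Nat.sInf_le ⟨D.par z, by simp, rfl⟩
  · refine le_csInf ⟨_, D.par z, by simp, rfl⟩ ?_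
    rintro n ⟨x, hx, rfl⟩
    rcases Sym2.mem_iff.1 hx with rfl | rfl <;> omega

theorem finite_children (hlf : ∀ v : V, (T.neighborSet v).Finite) (x : V) :
    {y : V | y ≠ O ∧ D.par y = x}.Finite :=
  (hlf x).subset fun _ hy => hy.2 ▸ D.adj_par hy.1

omit D in
theorem ne_root_of_dist_pos {z : V} (h : 0 < T.dist O z) : z ≠ O := by
  rintro rfl; simp at h

theorem dist_iterate (z : V) (k : ℕ) (hk : k ≤ T.dist O z) :
    T.dist O (D.par^[k] z) + k = T.dist O z := by
  induction k with
  | zero => simp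
  | succ k ih =>
    have h := ih (by omega)
    have hne : D.par^[k] z ≠ O := ne_root_of_dist_pos (T := T) (by omega)
    have := D.dist_eq _ hne
    rw [Function.iterate_succ_apply']
    omega

theorem iterate_ne_root {z : V} {k : ℕ} (hk : k < T.dist O z) : D.par^[k] z ≠ O :=
  ne_root_of_dist_pos (T := T) (by have := D.dist_iterate z k hk.le; omega)

omit D in
theorem eq_root_of_dist_eq_zero (hT : T.IsTree) {z : V} (h : T.dist O z = 0) : z = O :=
  (((hT.connected O z).dist_eq_zero_iff).1 h).symm

theorem iterate_dist_eq_root (hT : T.IsTree) (z : V) : D.par^[T.dist O z] z = O :=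
  eq_root_of_dist_eq_zero hT (by have := D.dist_iterate z _ le_rfl; omega)

end ParentData
end RootedTree

section Bernoulli

variable {ι : Type*} {p : ℝ}

theorem isProbabilityMeasure_bernoulliMeasure (hp : p ∈ Set.Icc (0 : ℝ) 1) :
    IsProbabilityMeasure (bernoulliMeasure p) := by
  refine ⟨?_⟩
  simp only [bernoulliMeasure, Measure.coe_add, Measure.coe_smul, Pi.add_apply, Pi.smul_apply,
    measure_univ, smul_eq_mul, mul_one]
  rw [← ENNReal.ofReal_add hp.1 (by linarith [hp.2])]
  simp

theorem bernoulliMeasure_singleton_true : bernoulliMeasure p {true} = ENNReal.ofReal p := by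
  simp [bernoulliMeasure]

theorem bernoulliProduct_cylinder_le (hp : p ∈ Set.Icc (0 : ℝ) 1) (s : Finset ι) :
    bernoulliProduct ι p {ω | ∀ i ∈ s, ω i = true} ≤ ENNReal.ofReal p ^ s.card := by
  have := isProbabilityMeasure_bernoulliMeasure hp
  refine (OuterMeasure.ofFunction_le _).trans ?_
  split_ifs
  · exact zero_le
  rw [ENNReal.tprod_eq_iInf_prod fun i => prob_le_one]
  refine (iInf_le _ s).trans ?_
  rw [← Finset.prod_const]
  refine Finset.prod_le_prod' fun i hi => ?_
  rw [← bernoulliMeasure_singleton_true]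
  refine measure_mono ?_
  rintro _ ⟨ω, hω, rfl⟩
  exact hω i hi

theorem infinitePi_le_bernoulliProduct [IsProbabilityMeasure (bernoulliMeasure p)]
    (A : Set (ι → Bool)) :
    Measure.infinitePi (fun _ : ι => bernoulliMeasure p) A ≤ bernoulliProduct ι p A := by
  let P := Measure.infinitePi (fun _ : ι => bernoulliMeasure p)
  suffices h : P.toOuterMeasure ≤ bernoulliProduct ι p from h A
  refine OuterMeasure.le_ofFunction.2 fun A => ?_
  split_ifs with hA
  · simp [hA]
  rw [ENNReal.tprod_eq_iInf_prod fun i => prob_le_one]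
  refine le_iInf fun s => ?_
  rw [← Measure.infinitePi_pi (fun _ : ι => bernoulliMeasure p)
    (t := fun i => Function.eval i '' A) fun i _ => MeasurableSet.of_discrete]
  exact measure_mono fun ω hω i _ => ⟨ω, hω, rfl⟩

/-- The σ-algebra generated by the coordinates in `S`. -/
abbrev coordSigma (S : Set ι) : MeasurableSpace (ι → Bool) :=
  ⨆ i ∈ S, MeasurableSpace.comap (fun ω : ι → Bool => ω i) ⊤

theorem coordSigma_mono {S S' : Set ι} (h : S ⊆ S') : coordSigma S ≤ coordSigma S' :=
  biSup_mono h

theorem coordSigma_le (S : Set ι) : coordSigma S ≤ MeasurableSpace.pi :=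
  iSup₂_le fun i _ => (measurable_pi_apply i).comap_le

theorem measurableSet_coordSigma {S : Set ι} {i : ι} (hi : i ∈ S) :
    MeasurableSet[coordSigma S] {ω : ι → Bool | ω i = true} :=
  le_iSup₂ (f := fun i (_ : i ∈ S) => MeasurableSpace.comap (fun ω : ι → Bool => ω i) ⊤) i hi _
    ⟨{true}, trivial, rfl⟩

theorem infinitePi_inter_of_disjoint [IsProbabilityMeasure (bernoulliMeasure p)]
    {S S' : Set ι} (h : Disjoint S S') {A B : Set (ι → Bool)}
    (hA : MeasurableSet[coordSigma S] A) (hB : MeasurableSet[coordSigma S'] B) :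
    Measure.infinitePi (fun _ : ι => bernoulliMeasure p) (A ∩ B) =
      Measure.infinitePi (fun _ : ι => bernoulliMeasure p) A *
        Measure.infinitePi (fun _ : ι => bernoulliMeasure p) B := by
  have hind := ProbabilityTheory.iIndepFun_infinitePi (P := fun _ : ι => bernoulliMeasure p)
    (X := fun _ b => b) fun _ => measurable_id
  exact (ProbabilityTheory.Indep_iff _ _ _).1 (ProbabilityTheory.indep_iSup_of_disjoint
    (fun i => (measurable_pi_apply i).comap_le) hind h) A B hA hB

theorem infinitePi_open [IsProbabilityMeasure (bernoulliMeasure p)] (i : ι) :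
    Measure.infinitePi (fun _ : ι => bernoulliMeasure p) {ω | ω i = true} = ENNReal.ofReal p := by
  have h := Measure.infinitePi_pi (fun _ : ι => bernoulliMeasure p) (s := {i})
    (t := fun _ => {true}) fun i _ => MeasurableSet.of_discrete
  rw [Finset.prod_singleton, bernoulliMeasure_singleton_true] at h
  rw [← h]
  congr 1
  ext ω
  simp

end Bernoulli

namespace ParentData

variable {V : Type*} {T : SimpleGraph V} {O : V} (D : ParentData T O)

/-- The event that the first `k` edges on the path from `z` towards the root are open. -/
def upPathOpen (k : ℕ) (z : V) : Set (T.edgeSet → Bool) :=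
  {ω | ∀ i < k, ω (D.edge (D.par^[i] z)) = true}

theorem bernoulliProduct_upPathOpen_le {p : ℝ} (hp : p ∈ Set.Icc (0 : ℝ) 1) {k : ℕ} {z : V}
    (hk : k ≤ T.dist O z) :
    bernoulliProduct T.edgeSet p (D.upPathOpen k z) ≤ ENNReal.ofReal p ^ k := by
  have hcard : ((Finset.range k).image fun i => D.edge (D.par^[i] z)).card = k := by
    rw [Finset.card_image_of_injOn, Finset.card_range]
    intro i hi j hj hij
    simp only [Finset.coe_range, Set.mem_Iio] at hi hj
    have h := D.edge_injOn (D.iterate_ne_root (by omega)) (D.iterate_ne_root (by omega)) hij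
    have h1 := D.dist_iterate z i (by omega)
    have h2 := D.dist_iterate z j (by omega)
    rw [h] at h1
    omega
  have h := bernoulliProduct_cylinder_le hp ((Finset.range k).image fun i => D.edge (D.par^[i] z))
  rw [hcard] at h
  refine le_trans (measure_mono ?_) h
  intro ω hω e he
  obtain ⟨i, hi, rfl⟩ := Finset.mem_image.1 he
  exact hω i (Finset.mem_range.1 hi)

theorem openSubgraph_adj_par {ω : T.edgeSet → Bool} {z : V} (hz : z ≠ O) :
    (openSubgraph T ω).Adj (D.par z) z ↔ ω (D.edge z) = true := by
  have h := D.edge_eq z hz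
  have he : s(D.par z, z) ∈ T.edgeSet := D.adj_par hz
  have hval : D.edge z = ⟨s(D.par z, z), he⟩ := Subtype.ext h
  rw [openSubgraph, SimpleGraph.deleteEdges_adj, hval]
  constructor
  · rintro ⟨-, h2⟩
    by_contra h3
    exact h2 ⟨he, by simpa using h3⟩
  · rintro h2
    refine ⟨he, ?_⟩
    rintro ⟨_, h3⟩
    simp [h2] at h3

theorem openSubgraph_adj {ω : T.edgeSet → Bool} {a b : V} (h : (openSubgraph T ω).Adj a b) :
    (a ≠ O ∧ D.par a = b ∧ ω (D.edge a) = true) ∨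
      (b ≠ O ∧ D.par b = a ∧ ω (D.edge b) = true) := by
  rcases D.adj a b (SimpleGraph.deleteEdges_adj.1 h).1 with ⟨h1, h2⟩ | ⟨h1, h2⟩
  · exact .inl ⟨h1, h2, (D.openSubgraph_adj_par h1).1 (h2 ▸ h.symm)⟩
  · exact .inr ⟨h1, h2, (D.openSubgraph_adj_par h1).1 (h2 ▸ h)⟩

theorem exists_infinite_openDescendants {ω : T.edgeSet → Bool} (hω : HasInfiniteCluster T ω) :
    ∃ x, {z | ∃ k ≤ T.dist O z, D.par^[k] z = x ∧ ω ∈ D.upPathOpen k z}.Infinite := by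
  obtain ⟨v, hv⟩ := hω
  let C := {w : V | (openSubgraph T ω).Reachable v w}
  obtain ⟨x, hx, hmin⟩ := exists_minimalFor_of_wellFoundedLT (· ∈ C) (T.dist O)
    ⟨v, SimpleGraph.Reachable.refl v⟩
  refine ⟨x, hv.mono fun w hw => ?_⟩
  have hxw : Relation.ReflTransGen (openSubgraph T ω).Adj x w :=
    (SimpleGraph.reachable_iff_reflTransGen _ _).1 (hx.symm.trans hw)
  clear hw
  induction hxw with
  | refl => exact ⟨0, Nat.zero_le _, rfl, fun i hi => absurd hi (Nat.not_lt_zero _)⟩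
  | @tail a b hxa hab ih =>
    obtain ⟨k, hk, hkx, hopen⟩ := ih
    rcases D.openSubgraph_adj hab with ⟨ha, rfl, -⟩ | ⟨hb, rfl, hob⟩
    · have hd := D.dist_eq a ha
      cases k with
      | zero =>
        obtain rfl : a = x := hkx
        have := hmin (j := D.par a) (hx.trans hab.reachable)
        omega
      | succ k =>
        refine ⟨k, by omega, hkx, fun i hi => ?_⟩
        exact hopen (i + 1) (by omega)
    · have hd := D.dist_eq b hb
      refine ⟨k + 1, by omega, hkx, fun i hi => ?_⟩
      cases i with
      | zero => exact hob
      | succ i => exact hopen i (by omega)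

theorem reachable_deleteEdges_of_lt (hT : T.IsTree) {π : Set (Sym2 V)} {x : V}
    (hπ : ∀ z, z ≠ O → (D.edge z : Sym2 V) ∈ π → T.dist O x < T.dist O z) :
    (T.deleteEdges π).Reachable O x := by
  induction hn : T.dist O x generalizing x with
  | zero => rw [eq_root_of_dist_eq_zero hT hn]
  | succ n ih =>
    have hx : x ≠ O := ne_root_of_dist_pos (T := T) (by omega)
    have hd := D.dist_eq x hx
    refine (ih (x := D.par x) (fun z hz hzπ => ?_) (by omega)).trans
      (SimpleGraph.Adj.reachable ?_)
    · have := hπ z hz hzπ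
      omega
    · rw [SimpleGraph.deleteEdges_adj]
      refine ⟨D.adj_par hx, fun h => ?_⟩
      rw [← D.edge_eq x hx] at h
      exact lt_irrefl _ (hπ x hx h)

/-- First-moment bound for the event that `x` has infinitely many open descendants. -/
theorem bernoulliProduct_infinite_openDescendants_le (hT : T.IsTree)
    (hlf : ∀ v : V, (T.neighborSet v).Finite) {p : ℝ} (hp : p ∈ Set.Icc (0 : ℝ) 1) {x : V}
    {π : Set (Sym2 V)} (hcut : IsCutset T O π)
    (hπ : ∀ z, z ≠ O → (D.edge z : Sym2 V) ∈ π → T.dist O x < T.dist O z) :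
    ENNReal.ofReal p ^ T.dist O x * bernoulliProduct T.edgeSet p
      {ω | {z | ∃ k ≤ T.dist O z, D.par^[k] z = x ∧ ω ∈ D.upPathOpen k z}.Infinite} ≤
      ∑' e : π, ENNReal.ofReal (p ^ edgeDist T O e) := by
  have := D.countable hlf
  let Z := {z : V // z ≠ O ∧ (D.edge z : Sym2 V) ∈ π}
  have hsub : {ω | {z | ∃ k ≤ T.dist O z, D.par^[k] z = x ∧ ω ∈ D.upPathOpen k z}.Infinite} ⊆
      ⋃ z : Z, D.upPathOpen (T.dist O z.1 - T.dist O x) z.1 := by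
    intro ω hω
    obtain ⟨y, ⟨k, hk, rfl, hopen⟩, hyK⟩ := (hω.sdiff hcut).nonempty
    have hxK : (T.deleteEdges π).Reachable O (D.par^[k] y) := D.reachable_deleteEdges_of_lt hT hπ
    have hex : ∃ i, (T.deleteEdges π).Reachable O (D.par^[i] y) := ⟨k, hxK⟩
    have hj := Nat.find_spec hex
    have hjk : Nat.find hex ≤ k := Nat.find_min' hex hxK
    obtain ⟨i, hi⟩ : ∃ i, Nat.find hex = i + 1 := by
      refine Nat.exists_eq_succ_of_ne_zero fun h0 => hyK ?_
      rw [h0] at hj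
      exact hj
    have hni : ¬ (T.deleteEdges π).Reachable O (D.par^[i] y) := Nat.find_min hex (by omega)
    have hne : D.par^[i] y ≠ O := D.iterate_ne_root (by omega)
    rw [hi, Function.iterate_succ_apply'] at hj
    have hmem : (D.edge (D.par^[i] y) : Sym2 V) ∈ π := by
      by_contra hnot
      refine hni (hj.trans (SimpleGraph.Adj.reachable ?_))
      rw [SimpleGraph.deleteEdges_adj, ← D.edge_eq _ hne]
      exact ⟨D.adj_par hne, hnot⟩
    refine Set.mem_iUnion.2 ⟨⟨_, hne, hmem⟩, fun l hl => ?_⟩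
    have h1 := D.dist_iterate y i (by omega)
    have h2 := D.dist_iterate y k hk
    rw [← Function.iterate_add_apply]
    exact hopen (l + i) (by simp only at hl; omega)
  calc ENNReal.ofReal p ^ T.dist O x * bernoulliProduct T.edgeSet p _
      ≤ ENNReal.ofReal p ^ T.dist O x * ∑' z : Z, ENNReal.ofReal p ^
        (T.dist O z.1 - T.dist O x) := by
        gcongr
        refine (measure_mono hsub).trans ((measure_iUnion_le _).trans ?_)
        exact ENNReal.tsum_le_tsum fun z => D.bernoulliProduct_upPathOpen_le hp (Nat.sub_le _ _)
    _ = ∑' z : Z, ENNReal.ofReal p ^ T.dist O z.1 := by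
        rw [← ENNReal.tsum_mul_left]
        refine tsum_congr fun z => ?_
        rw [← pow_add, Nat.add_sub_cancel' (hπ z.1 z.2.1 z.2.2).le]
    _ ≤ ∑' z : Z, ENNReal.ofReal (p ^ edgeDist T O (D.edge z.1)) := by
        refine ENNReal.tsum_le_tsum fun z => ?_
        rw [D.edgeDist_edge z.2.1, ENNReal.ofReal_pow hp.1, D.dist_eq z.1 z.2.1]
        exact pow_le_pow_right_of_le_one' (ENNReal.ofReal_le_one.2 hp.2) (Nat.le_succ _)
    _ ≤ ∑' e : π, ENNReal.ofReal (p ^ edgeDist T O e) := by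
        refine ENNReal.tsum_comp_le_tsum_of_injective
          (f := fun z : Z => (⟨(D.edge z.1 : Sym2 V), z.2.2⟩ : π)) (fun a b hab => ?_)
          (fun e : π => ENNReal.ofReal (p ^ edgeDist T O e))
        exact Subtype.ext (D.edge_injOn a.2.1 b.2.1 (Subtype.ext (Subtype.mk.inj hab)))

include D in
theorem bernoulliProduct_hasInfiniteCluster_eq_zero (hT : T.IsTree)
    (hlf : ∀ v : V, (T.neighborSet v).Finite) {p : ℝ} (hp : p ∈ Set.Ioc (0 : ℝ) 1)
    (hinf : ⨅ π : {π : Set (Sym2 V) // IsCutset T O π},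
      ∑' e : π.1, ENNReal.ofReal (p ^ edgeDist T O e) = 0) :
    bernoulliProduct T.edgeSet p {ω | HasInfiniteCluster T ω} = 0 := by
  have hp' : p ∈ Set.Icc (0 : ℝ) 1 := ⟨hp.1.le, hp.2⟩
  have := D.countable hlf
  have hp0 : ENNReal.ofReal p ≠ 0 := by simpa using hp.1
  refine measure_mono_null (t := ⋃ x, {ω | {z | ∃ k ≤ T.dist O z, D.par^[k] z = x ∧
    ω ∈ D.upPathOpen k z}.Infinite}) (fun ω hω => Set.mem_iUnion.2
      (D.exists_infinite_openDescendants hω)) (measure_iUnion_null fun x => ?_)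
  suffices h : ENNReal.ofReal p ^ T.dist O x * bernoulliProduct T.edgeSet p
      {ω | {z | ∃ k ≤ T.dist O z, D.par^[k] z = x ∧ ω ∈ D.upPathOpen k z}.Infinite} = 0 from
    (mul_eq_zero.1 h).resolve_left (pow_ne_zero _ hp0)
  by_contra hne
  have hlt := hinf.trans_lt (lt_min (pos_iff_ne_zero.2 hne)
    (pos_iff_ne_zero.2 (pow_ne_zero (T.dist O x) hp0)))
  obtain ⟨⟨π, hcut⟩, hπ⟩ := iInf_lt_iff.1 hlt
  refine absurd (D.bernoulliProduct_infinite_openDescendants_le hT hlf hp' hcut ?_)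
    (hπ.trans_le (min_le_left _ _)).not_ge
  intro z hz hzπ
  by_contra hle
  refine absurd (ENNReal.le_tsum (f := fun e : π => ENNReal.ofReal (p ^ edgeDist T O e))
    ⟨_, hzπ⟩) (not_le.2 ((hπ.trans_le (min_le_right _ _)).trans_le ?_))
  rw [D.edgeDist_edge hz, ENNReal.ofReal_pow hp'.1]
  have := D.dist_eq z hz
  exact pow_le_pow_right_of_le_one' (ENNReal.ofReal_le_one.2 hp.2) (by omega)

end ParentData

theorem infinitePi_compl_biUnion_mul_le {ι α : Type*} {p : ℝ}
    [IsProbabilityMeasure (bernoulliMeasure p)] (s : Finset α) (S : α → Set ι)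
    (hS : (s : Set α).Pairwise fun a b => Disjoint (S a) (S b)) (B : α → Set (ι → Bool))
    (hB : ∀ a ∈ s, MeasurableSet[coordSigma (S a)] (B a)) :
    (Measure.infinitePi fun _ : ι => bernoulliMeasure p).real (⋃ a ∈ s, B a)ᶜ *
      (1 + ∑ a ∈ s, (Measure.infinitePi fun _ : ι => bernoulliMeasure p).real (B a)) ≤ 1 := by
  set P := Measure.infinitePi fun _ : ι => bernoulliMeasure p with hP
  induction s using Finset.induction_on with
  | empty => simp
  | insert a s ha ih =>
    have hdisj : Disjoint (S a) (⋃ b ∈ s, S b) := by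
      refine Set.disjoint_iUnion₂_right.2 fun b hb => hS (by simp) (by simp [hb]) ?_
      rintro rfl
      exact ha hb
    have hmeas : MeasurableSet[coordSigma (⋃ b ∈ s, S b)] (⋃ b ∈ s, B b)ᶜ := by
      refine MeasurableSet.compl (MeasurableSet.biUnion s.countable_toSet fun b hb => ?_)
      exact coordSigma_mono (Set.subset_biUnion_of_mem (u := S) hb) _
        (hB b (Finset.mem_insert_of_mem hb))
    have hBa := hB a (Finset.mem_insert_self a s)
    have hprod : P.real (⋃ b ∈ insert a s, B b)ᶜ = (1 - P.real (B a)) * P.real (⋃ b ∈ s, B b)ᶜ := by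
      rw [Finset.set_biUnion_insert, Set.compl_union, ← probReal_compl_eq_one_sub
        (coordSigma_le _ _ hBa), measureReal_def, infinitePi_inter_of_disjoint hdisj
        (MeasurableSet.compl hBa) hmeas, ENNReal.toReal_mul]
      rfl
    have ih' := ih (hS.mono (by simp)) fun b hb => hB b (Finset.mem_insert_of_mem hb)
    rw [hprod, Finset.sum_insert ha]
    have h0 : 0 ≤ P.real (⋃ b ∈ s, B b)ᶜ := measureReal_nonneg
    have h1 : 0 ≤ P.real (B a) := measureReal_nonneg
    have h2 : 0 ≤ ∑ b ∈ s, P.real (B b) := Finset.sum_nonneg fun _ _ => measureReal_nonneg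
    refine le_trans ?_ ih'
    have h3 : (1 - P.real (B a)) * (1 + (P.real (B a) + ∑ b ∈ s, P.real (B b))) ≤
        1 + ∑ b ∈ s, P.real (B b) := by
      nlinarith [mul_nonneg h1 h2, mul_nonneg h1 h1]
    calc _ = P.real (⋃ b ∈ s, B b)ᶜ *
          ((1 - P.real (B a)) * (1 + (P.real (B a) + ∑ b ∈ s, P.real (B b)))) := by ring
      _ ≤ _ := mul_le_mul_of_nonneg_left h3 h0

namespace ParentData

variable {V : Type*} {T : SimpleGraph V} {O : V} (D : ParentData T O)
  (hlf : ∀ v : V, (T.neighborSet v).Finite)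

/-- The children of a vertex. -/
noncomputable def children (x : V) : Finset V := (D.finite_children hlf x).toFinset

theorem mem_children {x y : V} : y ∈ D.children hlf x ↔ y ≠ O ∧ D.par y = x := by
  simp [children]

theorem dist_of_mem_children {x y : V} (hy : y ∈ D.children hlf x) :
    T.dist O y = T.dist O x + 1 := by
  obtain ⟨h, rfl⟩ := (D.mem_children hlf).1 hy
  exact D.dist_eq y h

/-- The event that `x` is joined by an open path to a descendant `n` generations below it. -/
noncomputable def survival : ℕ → V → Set (T.edgeSet → Bool)
  | 0, _ => Set.univ
  | n + 1, x => ⋃ y ∈ D.children hlf x, {ω | ω (D.edge y) = true} ∩ survival n y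

/-- The edges leading to a descendant at least `j` generations below `x`. -/
def edgesBelow (j : ℕ) (x : V) : Set T.edgeSet :=
  {e | ∃ z k, z ≠ O ∧ j ≤ k ∧ D.par^[k] z = x ∧ T.dist O z = T.dist O x + k ∧ D.edge z = e}

theorem edge_mem_edgesBelow {y : V} (hy : y ≠ O) : D.edge y ∈ D.edgesBelow 0 y :=
  ⟨y, 0, hy, le_rfl, rfl, rfl, rfl⟩

theorem edgesBelow_subset {x y : V} (hy : y ∈ D.children hlf x) :
    D.edgesBelow 0 y ⊆ D.edgesBelow 1 x := by
  rintro _ ⟨z, k, hz, -, hk, hd, rfl⟩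
  have := D.dist_of_mem_children hlf hy
  refine ⟨z, k + 1, hz, by omega, ?_, by omega, rfl⟩
  rw [Function.iterate_succ_apply', hk, ((D.mem_children hlf).1 hy).2]

theorem edgesBelow_anti (x : V) : D.edgesBelow 1 x ⊆ D.edgesBelow 0 x := by
  rintro _ ⟨z, k, hz, -, hk, hd, rfl⟩
  exact ⟨z, k, hz, Nat.zero_le k, hk, hd, rfl⟩

theorem disjoint_edge_edgesBelow {y : V} (hy : y ≠ O) :
    Disjoint {D.edge y} (D.edgesBelow 1 y) := by
  rw [Set.disjoint_singleton_left]
  rintro ⟨z, k, hz, hk1, hk, hd, he⟩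
  rw [D.edge_injOn hz hy he] at hd
  omega

theorem disjoint_edgesBelow {y y' : V} (hne : y ≠ y') (hd : T.dist O y = T.dist O y') :
    Disjoint (D.edgesBelow 0 y) (D.edgesBelow 0 y') := by
  rw [Set.disjoint_left]
  rintro _ ⟨z, k, hz, -, hk, hkd, rfl⟩ ⟨z', k', hz', -, hk', hkd', he⟩
  obtain rfl := D.edge_injOn hz' hz he
  obtain rfl : k = k' := by omega
  exact hne (hk.symm.trans hk')

theorem measurableSet_survival (n : ℕ) (x : V) :
    MeasurableSet[coordSigma (D.edgesBelow 1 x)] (D.survival hlf n x) := by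
  induction n generalizing x with
  | zero => exact MeasurableSet.univ
  | succ n ih =>
    refine MeasurableSet.biUnion (Finset.countable_toSet _) fun y hy => ?_
    have hsub := D.edgesBelow_subset hlf hy
    exact MeasurableSet.inter
      (measurableSet_coordSigma (hsub (D.edge_mem_edgesBelow ((D.mem_children hlf).1 hy).1)))
      (coordSigma_mono ((D.edgesBelow_anti y).trans hsub) _ (ih y))

theorem survival_succ_subset (n : ℕ) (x : V) :
    D.survival hlf (n + 1) x ⊆ D.survival hlf n x := by
  induction n generalizing x with
  | zero => exact Set.subset_univ _
  | succ n ih => exact Set.iUnion₂_mono fun y _ => Set.inter_subset_inter_right _ (ih y)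

theorem exists_reachable_of_mem_survival {n : ℕ} {x : V} {ω : T.edgeSet → Bool}
    (h : ω ∈ D.survival hlf n x) :
    ∃ w, (openSubgraph T ω).Reachable x w ∧ T.dist O w = T.dist O x + n := by
  induction n generalizing x with
  | zero => exact ⟨x, SimpleGraph.Reachable.refl x, rfl⟩
  | succ n ih =>
    obtain ⟨y, hy, hopen, hs⟩ := Set.mem_iUnion₂.1 h
    obtain ⟨w, hw, hd⟩ := ih hs
    have hyd := D.dist_of_mem_children hlf hy
    obtain ⟨hyO, rfl⟩ := (D.mem_children hlf).1 hy
    exact ⟨w, ((D.openSubgraph_adj_par hyO).2 hopen).reachable.trans hw, by omega⟩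

theorem hasInfiniteCluster_of_forall_mem_survival {ω : T.edgeSet → Bool}
    (h : ∀ n, ω ∈ D.survival hlf n O) : HasInfiniteCluster T ω := by
  refine ⟨O, Set.Infinite.of_image (T.dist O) ?_⟩
  refine Set.infinite_univ.mono fun n _ => ?_
  obtain ⟨w, hw, hd⟩ := D.exists_reachable_of_mem_survival hlf (h n)
  exact ⟨w, hw, by simpa using hd⟩

/-- The minimal cut value of the tree of the first `n` generations below `x`, an edge `k`
generations below `x` having capacity `r ^ k`, and the edge above `x` being available too. -/
noncomputable def cutValue (r : ℝ) : ℕ → V → ℝ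
  | 0, _ => 1
  | n + 1, x => min 1 (r * ∑ y ∈ D.children hlf x, cutValue r n y)

theorem cutValue_le_one (r : ℝ) (n : ℕ) (x : V) : D.cutValue hlf r n x ≤ 1 := by
  cases n with
  | zero => exact le_rfl
  | succ n => exact min_le_left _ _

theorem cutValue_nonneg {r : ℝ} (hr : 0 ≤ r) (n : ℕ) (x : V) : 0 ≤ D.cutValue hlf r n x := by
  induction n generalizing x with
  | zero => exact zero_le_one
  | succ n ih => exact le_min zero_le_one (mul_nonneg hr (Finset.sum_nonneg fun y _ => ih y))

theorem le_measureReal_survival {p r : ℝ} [IsProbabilityMeasure (bernoulliMeasure p)]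
    (hr : 0 < r) (hrp : r < p) (n : ℕ) (x : V) :
    (1 - r / p) * D.cutValue hlf r n x ≤
      (Measure.infinitePi fun _ : T.edgeSet => bernoulliMeasure p).real (D.survival hlf n x) := by
  set P := Measure.infinitePi fun _ : T.edgeSet => bernoulliMeasure p with hP
  have hp : 0 < p := hr.trans hrp
  have hδ : 0 ≤ 1 - r / p := by rw [sub_nonneg, div_le_one hp]; exact hrp.le
  induction n generalizing x with
  | zero =>
    simp only [cutValue, survival, mul_one, probReal_univ]
    linarith [div_pos hr hp]
  | succ n ih =>
    let B : V → Set (T.edgeSet → Bool) := fun y =>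
      {ω | ω (D.edge y) = true} ∩ D.survival hlf n y
    have hBm : ∀ y ∈ D.children hlf x, MeasurableSet[coordSigma (D.edgesBelow 0 y)] (B y) :=
      fun y hy => MeasurableSet.inter
        (measurableSet_coordSigma (D.edge_mem_edgesBelow ((D.mem_children hlf).1 hy).1))
        (coordSigma_mono (D.edgesBelow_anti y) _ (D.measurableSet_survival hlf n y))
    have hBP : ∀ y ∈ D.children hlf x, P.real (B y) = p * P.real (D.survival hlf n y) := by
      intro y hy
      rw [measureReal_def, infinitePi_inter_of_disjoint
        (D.disjoint_edge_edgesBelow ((D.mem_children hlf).1 hy).1)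
        (measurableSet_coordSigma rfl) (D.measurableSet_survival hlf n y), infinitePi_open,
        ENNReal.toReal_mul, ENNReal.toReal_ofReal hp.le]
      rfl
    have hkey := infinitePi_compl_biUnion_mul_le (p := p) (D.children hlf x) (D.edgesBelow 0)
      (fun y hy y' hy' hne => D.disjoint_edgesBelow hne
        ((D.dist_of_mem_children hlf hy).trans (D.dist_of_mem_children hlf hy').symm)) B hBm
    have hU : ⋃ y ∈ D.children hlf x, B y = D.survival hlf (n + 1) x := rfl
    rw [← hP, hU, probReal_compl_eq_one_sub
      (coordSigma_le _ _ (D.measurableSet_survival hlf (n + 1) x)),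
      Finset.sum_congr rfl hBP, ← Finset.mul_sum] at hkey
    have hm1 := D.cutValue_le_one hlf r (n + 1) x
    have hm0 := D.cutValue_nonneg hlf hr.le (n + 1) x
    have hm : D.cutValue hlf r (n + 1) x ≤ r * ∑ y ∈ D.children hlf x, D.cutValue hlf r n y :=
      min_le_right _ _
    have hsum : (1 - r / p) * ∑ y ∈ D.children hlf x, D.cutValue hlf r n y ≤
        ∑ y ∈ D.children hlf x, P.real (D.survival hlf n y) := by
      rw [Finset.mul_sum]
      exact Finset.sum_le_sum fun y _ => ih y
    generalize P.real (D.survival hlf (n + 1) x) = a at *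
    generalize D.cutValue hlf r (n + 1) x = m at *
    generalize ∑ y ∈ D.children hlf x, D.cutValue hlf r n y = u at *
    generalize ∑ y ∈ D.children hlf x, P.real (D.survival hlf n y) = t at *
    have hrδ : r = p * (1 - (1 - r / p)) := by field_simp; ring
    generalize 1 - r / p = δ at *
    have hu : 0 ≤ u := nonneg_of_mul_nonneg_right (hm0.trans hm) hr
    have hpt : 0 ≤ p * t := mul_nonneg hp.le ((mul_nonneg hδ hu).trans hsum)
    have hδ1 : 0 ≤ 1 - δ := nonneg_of_mul_nonneg_right (hrδ ▸ hr.le) hp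
    have hδm : δ * m ≤ δ := mul_le_of_le_one_right hδ hm1
    by_contra! hlt
    have h1 : a * (1 + p * t) < δ * m * (1 + p * t) :=
      mul_lt_mul_of_pos_right hlt (by linarith)
    have h2 : δ * m ≤ p * t * (1 - δ) := by
      calc δ * m ≤ δ * (r * u) := mul_le_mul_of_nonneg_left hm hδ
        _ = p * (1 - δ) * (δ * u) := by rw [hrδ]; ring
        _ ≤ p * (1 - δ) * t := mul_le_mul_of_nonneg_left hsum (mul_nonneg hp.le hδ1)
        _ = p * t * (1 - δ) := by ring
    have h3 : p * t * (1 - δ) ≤ p * t * (1 - δ * m) :=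
      mul_le_mul_of_nonneg_left (by linarith) hpt
    linarith

end ParentData

namespace ParentData

variable {V : Type*} {T : SimpleGraph V} {O : V} (D : ParentData T O)
  (hlf : ∀ v : V, (T.neighborSet v).Finite)

/-- Every descending path of length `n` from `x` meets `Z`. -/
def IsLevelCut (n : ℕ) (x : V) (Z : Set V) : Prop :=
  ∀ w, D.par^[n] w = x → T.dist O w = T.dist O x + n → ∃ i ≤ n, D.par^[i] w ∈ Z

theorem exists_isLevelCut_succ {r : ℝ} (hr : 0 ≤ r) {n : ℕ} {x : V}
    (h : ∀ y, ∃ Z, (∀ z ∈ Z, T.dist O y ≤ T.dist O z) ∧ D.IsLevelCut n y Z ∧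
      ∑' z : Z, ENNReal.ofReal (r ^ T.dist O z.1) ≤
        ENNReal.ofReal (r ^ T.dist O y * D.cutValue hlf r n y)) :
    ∃ Z, (∀ z ∈ Z, T.dist O x < T.dist O z) ∧ D.IsLevelCut (n + 1) x Z ∧
      ∑' z : Z, ENNReal.ofReal (r ^ T.dist O z.1) ≤
        ENNReal.ofReal (r ^ T.dist O x * (r * ∑ y ∈ D.children hlf x, D.cutValue hlf r n y)) := by
  choose Z hZd hZc hZw using h
  refine ⟨⋃ y ∈ D.children hlf x, Z y, ?_, ?_, ?_⟩
  · intro z hz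
    obtain ⟨y, hy, hzy⟩ := Set.mem_iUnion₂.1 hz
    have h1 := hZd y z hzy
    have h2 := D.dist_of_mem_children hlf hy
    omega
  · intro w hw hd
    have h1 := D.dist_iterate w n (by omega)
    rw [Function.iterate_succ_apply'] at hw
    have hy : D.par^[n] w ∈ D.children hlf x :=
      (D.mem_children hlf).2 ⟨D.iterate_ne_root (by omega), hw⟩
    obtain ⟨i, hi, hiZ⟩ := hZc _ w rfl (by omega)
    exact ⟨i, by omega, Set.mem_iUnion₂.2 ⟨_, hy, hiZ⟩⟩
  · refine (ENNReal.tsum_biUnion_le (fun z => ENNReal.ofReal (r ^ T.dist O z)) _ Z).trans ?_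
    rw [← mul_assoc, ← pow_succ, Finset.mul_sum, ENNReal.ofReal_sum_of_nonneg fun y _ =>
      mul_nonneg (pow_nonneg hr _) (D.cutValue_nonneg hlf hr n y)]
    refine Finset.sum_le_sum fun y hy => ?_
    rw [← D.dist_of_mem_children hlf hy]
    exact hZw y

theorem exists_isLevelCut {r : ℝ} (hr : 0 ≤ r) (n : ℕ) (x : V) :
    ∃ Z, (∀ z ∈ Z, T.dist O x ≤ T.dist O z) ∧ D.IsLevelCut n x Z ∧
      ∑' z : Z, ENNReal.ofReal (r ^ T.dist O z.1) ≤
        ENNReal.ofReal (r ^ T.dist O x * D.cutValue hlf r n x) := by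
  have hsingle : ∀ x n, ∃ Z, (∀ z ∈ Z, T.dist O x ≤ T.dist O z) ∧ D.IsLevelCut n x Z ∧
      ∑' z : Z, ENNReal.ofReal (r ^ T.dist O z.1) ≤ ENNReal.ofReal (r ^ T.dist O x * 1) := by
    refine fun x n => ⟨{x}, ?_, fun w hw _ => ⟨n, le_rfl, hw⟩, ?_⟩
    · rintro z rfl
      exact le_rfl
    · rw [tsum_singleton x fun z => ENNReal.ofReal (r ^ T.dist O z), mul_one]
  induction n generalizing x with
  | zero => exact hsingle x 0
  | succ n ih =>
    rw [cutValue]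
    rcases le_total 1 (r * ∑ y ∈ D.children hlf x, D.cutValue hlf r n y) with h | h
    · rw [min_eq_left h]
      exact hsingle x (n + 1)
    · rw [min_eq_right h]
      obtain ⟨Z, hZd, hZ⟩ := D.exists_isLevelCut_succ hlf hr (x := x) ih
      exact ⟨Z, fun z hz => (hZd z hz).le, hZ⟩

theorem isCutset_of_isLevelCut (hT : T.IsTree) (hlf : ∀ v : V, (T.neighborSet v).Finite) {n : ℕ}
    {Z : Set V} (hZO : ∀ z ∈ Z, z ≠ O) (hZ : D.IsLevelCut n O Z) :
    IsCutset T O ((fun z => (D.edge z : Sym2 V)) '' Z) := by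
  have hpath : ∀ w, (T.deleteEdges ((fun z => (D.edge z : Sym2 V)) '' Z)).Reachable O w →
      ∀ j < T.dist O w, D.par^[j] w ∉ Z := by
    intro w hw
    rw [SimpleGraph.reachable_iff_reflTransGen] at hw
    induction hw with
    | refl => simp
    | @tail a b _ hab ih =>
      rw [SimpleGraph.deleteEdges_adj] at hab
      rcases D.adj a b hab.1 with ⟨ha, rfl⟩ | ⟨hb, rfl⟩
      · intro j hj
        have := D.dist_eq a ha
        exact ih (j + 1) (by omega)
      · intro j hj
        have := D.dist_eq b hb
        cases j with
        | zero => exact fun hbZ => hab.2 ⟨b, hbZ, D.edge_eq b hb⟩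
        | succ j => exact ih j (by omega)
  refine (D.finite_dist_lt hlf n).subset fun w hw => ?_
  by_contra! hn
  simp only [Set.mem_ofPred_eq, not_lt] at hn
  have h1 := D.dist_iterate w (T.dist O w - n) (Nat.sub_le _ _)
  obtain ⟨i, hi, hiZ⟩ := hZ (D.par^[T.dist O w - n] w)
    (by rw [← Function.iterate_add_apply, Nat.add_sub_cancel' hn, D.iterate_dist_eq_root hT])
    (by rw [SimpleGraph.dist_self]; omega)
  rw [← Function.iterate_add_apply] at hiZ
  rcases (show i + (T.dist O w - n) ≤ T.dist O w by omega).lt_or_eq with h | h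
  · exact hpath w hw _ h hiZ
  · rw [h, D.iterate_dist_eq_root hT] at hiZ
    exact hZO O hiZ rfl

theorem le_cutValue_root (hT : T.IsTree) {r : ℝ} (hr : 0 ≤ r) (n : ℕ) :
    min 1 (ENNReal.ofReal r * ⨅ π : {π : Set (Sym2 V) // IsCutset T O π},
      ∑' e : π.1, ENNReal.ofReal (r ^ edgeDist T O e)) ≤
      ENNReal.ofReal (D.cutValue hlf r (n + 1) O) := by
  rw [cutValue]
  rcases le_total 1 (r * ∑ y ∈ D.children hlf O, D.cutValue hlf r n y) with h | h
  · rw [min_eq_left h, ENNReal.ofReal_one]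
    exact min_le_left _ _
  rw [min_eq_right h]
  refine (min_le_right _ _).trans ?_
  obtain ⟨Z, hZd, hZc, hZw⟩ := D.exists_isLevelCut_succ hlf hr (x := O)
    fun y => D.exists_isLevelCut hlf hr n y
  have hZO : ∀ z ∈ Z, z ≠ O := fun z hz => ne_root_of_dist_pos (T := T) (by
    have := hZd z hz; omega)
  rw [SimpleGraph.dist_self, pow_zero, one_mul] at hZw
  refine le_trans ?_ hZw
  refine (mul_le_mul_right (iInf_le _ ⟨_, D.isCutset_of_isLevelCut hT hlf hZO hZc⟩) _).trans ?_
  refine (mul_le_mul_right (ENNReal.tsum_le_tsum_comp_of_surjective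
    (Set.surjective_mapsTo_image_restrict (fun z => (D.edge z : Sym2 V)) Z) _) _).trans ?_
  rw [← ENNReal.tsum_mul_left]
  refine ENNReal.tsum_le_tsum fun z => ?_
  have hz := hZO z.1 z.2
  rw [← ENNReal.ofReal_mul hr, ← pow_succ', Set.MapsTo.val_restrict_apply, D.edgeDist_edge hz,
    D.dist_eq z.1 hz]

include D in
theorem bernoulliProduct_hasInfiniteCluster_ne_zero (hT : T.IsTree)
    (hlf : ∀ v : V, (T.neighborSet v).Finite) {p r : ℝ} (hp : p ≤ 1) (hr : 0 < r) (hrp : r < p)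
    (hpos : 0 < ⨅ π : {π : Set (Sym2 V) // IsCutset T O π},
      ∑' e : π.1, ENNReal.ofReal (r ^ edgeDist T O e)) :
    bernoulliProduct T.edgeSet p {ω | HasInfiniteCluster T ω} ≠ 0 := by
  have := isProbabilityMeasure_bernoulliMeasure ⟨(hr.trans hrp).le, hp⟩
  let P := Measure.infinitePi fun _ : T.edgeSet => bernoulliMeasure p
  have hδ : 0 < 1 - r / p := by rw [sub_pos, div_lt_one (hr.trans hrp)]; exact hrp
  have hanti : Antitone fun n => D.survival hlf n O :=
    antitone_nat_of_succ_le fun n => D.survival_succ_subset hlf n O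
  let K := ENNReal.ofReal (1 - r / p) * min 1 (ENNReal.ofReal r *
    ⨅ π : {π : Set (Sym2 V) // IsCutset T O π}, ∑' e : π.1, ENNReal.ofReal (r ^ edgeDist T O e))
  have hK : 0 < K := ENNReal.mul_pos (by simpa using hδ)
    (lt_min one_pos (ENNReal.mul_pos (by simpa using hr) hpos.ne')).ne'
  have hbound : ∀ n, K ≤ P (D.survival hlf n O) := by
    intro n
    refine le_trans ?_ (measure_mono (hanti n.le_succ))
    refine (mul_le_mul_right (D.le_cutValue_root hlf hT hr.le n) _).trans ?_
    rw [← ENNReal.ofReal_mul hδ.le, ← ofReal_measureReal]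
    exact ENNReal.ofReal_le_ofReal (D.le_measureReal_survival hlf hr hrp (n + 1) O)
  have hInter : K ≤ P (⋂ n, D.survival hlf n O) := by
    rw [hanti.measure_iInter (fun n => (coordSigma_le _ _
      (D.measurableSet_survival hlf n O)).nullMeasurableSet) ⟨0, measure_ne_top _ _⟩]
    exact le_iInf hbound
  refine (hK.trans_le (hInter.trans ?_)).ne'
  exact (measure_mono fun ω hω => D.hasInfiniteCluster_of_forall_mem_survival hlf
    (Set.mem_iInter.1 hω)).trans (infinitePi_le_bernoulliProduct _)

end ParentData

theorem one_le_tsum_of_isCutset {V : Type*} {T : SimpleGraph V} {O : V} (hT : T.Connected)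
    (hinf : Infinite V) {π : Set (Sym2 V)} (hπ : IsCutset T O π) :
    1 ≤ ∑' e : π, ENNReal.ofReal ((1 : ℝ)⁻¹ ^ edgeDist T O e) := by
  obtain ⟨e, he⟩ : π.Nonempty := by
    by_contra! h
    refine Set.infinite_univ (hπ.subset fun w _ => ?_)
    rw [h, SimpleGraph.deleteEdges_empty]
    exact hT O w
  exact le_trans (by simp) (ENNReal.le_tsum (f := fun e : π =>
    ENNReal.ofReal ((1 : ℝ)⁻¹ ^ edgeDist T O e)) ⟨e, he⟩)

/-- Lyons. For a locally finite, infinite tree `T` with root `O`,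
`p_c(T) = 1/br(T)` where `br(T)` is the branching number. -/
theorem pc_tree_eq_inv_branchingNumber {V : Type*} (T : SimpleGraph V) (O : V)
    (htree : T.IsTree) (hinf : Infinite V)
    (hlf : ∀ v : V, (T.neighborSet v).Finite) :
    pc T = 1 / branchingNumber T O := by
  obtain ⟨D⟩ := htree.nonempty_parentData O hinf
  have hnull {p : ℝ} (h0 : 0 < p) (h1 : p ≤ 1) (hp : ¬ 0 < ⨅ π : {π : Set (Sym2 V) //
      IsCutset T O π}, ∑' e : π.1, ENNReal.ofReal ((1 / p)⁻¹ ^ edgeDist T O e)) :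
      bernoulliProduct T.edgeSet p {ω | HasInfiniteCluster T ω} = 0 := by
    refine D.bernoulliProduct_hasInfiniteCluster_eq_zero htree hlf ⟨h0, h1⟩ ?_
    simpa only [one_div, inv_inv, not_lt, nonpos_iff_eq_zero] using hp
  have hone : (1 : ℝ) ∈ {l : ℝ | 1 ≤ l ∧ 0 < ⨅ π : {π : Set (Sym2 V) // IsCutset T O π},
      ∑' e : π.1, ENNReal.ofReal (l⁻¹ ^ edgeDist T O e)} :=
    ⟨le_rfl, one_pos.trans_le (le_iInf fun π =>
      one_le_tsum_of_isCutset htree.connected hinf π.2)⟩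
  have hpos {p l : ℝ} (hl : 1 ≤ l) (h1 : p ≤ 1) (hlp : 1 / p < l) (h0 : 0 < p)
      (h : 0 < ⨅ π : {π : Set (Sym2 V) // IsCutset T O π},
        ∑' e : π.1, ENNReal.ofReal (l⁻¹ ^ edgeDist T O e)) :
      bernoulliProduct T.edgeSet p {ω | HasInfiniteCluster T ω} ≠ 0 := by
    refine D.bernoulliProduct_hasInfiniteCluster_ne_zero htree hlf h1
      (inv_pos.2 (one_pos.trans_le hl)) ?_ h
    rw [one_div] at hlp
    exact inv_lt_of_inv_lt₀ h0 hlp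
  rw [pc, branchingNumber]
  set S := {l : ℝ | 1 ≤ l ∧ 0 < ⨅ π : {π : Set (Sym2 V) // IsCutset T O π},
      ∑' e : π.1, ENNReal.ofReal (l⁻¹ ^ edgeDist T O e)} with hS
  by_cases hbdd : BddAbove S
  · have hbr : 1 ≤ sSup S := le_csSup hbdd hone
    have hbr0 : 0 < 1 / sSup S := by positivity
    have hlower : ∀ w < 1 / sSup S, ∃ p ∈ {p : ℝ | p ∈ Set.Icc (0 : ℝ) 1 ∧
        bernoulliProduct T.edgeSet p {ω | HasInfiniteCluster T ω} = 0}, w < p := by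
      intro w hw
      obtain ⟨p, hp, hp'⟩ := exists_between (max_lt hw hbr0)
      obtain ⟨hwp, hp0⟩ := max_lt_iff.1 hp
      have hp1 : p ≤ 1 := hp'.le.trans ((div_le_one (by positivity)).2 hbr)
      refine ⟨p, ⟨⟨hp0.le, hp1⟩, hnull hp0 hp1 fun h => ?_⟩, hwp⟩
      exact absurd (le_csSup hbdd ⟨(one_le_div hp0).2 hp1, h⟩)
        (not_le.2 ((lt_one_div (by positivity) hp0).2 hp'))
    refine csSup_eq_of_forall_le_of_forall_lt_exists_gt ?_ ?_ hlower
    · obtain ⟨p, hp, -⟩ := hlower 0 hbr0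
      exact ⟨p, hp⟩
    · rintro p ⟨hp, hp0⟩
      by_contra! hlt
      have hp' : 0 < p := hbr0.trans hlt
      obtain ⟨l, ⟨hl1, hl⟩, hpl⟩ := exists_lt_of_lt_csSup ⟨1, hone⟩
        ((one_div_lt (by positivity) hp').1 hlt)
      exact hpos hl1 hp.2 hpl hp' hl hp0
  · rw [Real.sSup_of_not_bddAbove hbdd, div_zero]
    refine le_antisymm (Real.sSup_nonpos ?_) (Real.sSup_nonneg fun p hp => hp.1.1)
    rintro p ⟨hp, hp0⟩
    by_contra! hp'
    obtain ⟨l, ⟨hl1, hl⟩, hpl⟩ := not_bddAbove_iff.1 hbdd (1 / p)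
    exact hpos hl1 hp.2 hpl hp' hl hp0
end
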